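/- arXiv:2308.06109 — 2 statements merged into one kernel-verified Lean document; each statement's English description precedes it below -/
import Mathlib

section
/- For m ∈ {0,1,…,k-1}, every m-dimensional subcode of a q-ary simplex code of dimension k is contained in exactly [k-m]_q!·(q-1)^{[k-m]_q}·((q^{k-m})!)^{[m]_q} / ((q^{k-m}-1)(q^{k-m}-q)···(q^{k-m}-q^{k-m-1})·q^{m(k-m)}) distinct simplex codes, where [j]_q = (q^j-1)/(q-1). -/
open Module Submodule

/-- A `q`-ary simplex code of dimension `k`: a `k`-dimensional subspace of `F^n`
whose coordinate functional restrictions are nonzero and pairwise non-proportional. -/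
def IsSimplexCode {F : Type*} [Field F] {n : ℕ} (k : ℕ)
    (C : Submodule F (Fin n → F)) : Prop :=
  Module.finrank F ↥C = k ∧
  (∀ i : Fin n, ∃ c ∈ C, c i ≠ 0) ∧
  (∀ i j : Fin n, i ≠ j → ∀ a : F, ∃ c ∈ C, c j ≠ a * c i)

set_option linter.unusedSectionVars false
open scoped LinearAlgebra.Projectivization
section Helpers

variable {F A W I : Type*} [Field F] [Finite F] [AddCommGroup W] [Module F W] [Finite W]
  [AddCommGroup A] [Module F A] [Finite A] [Finite I]

lemma card_emb (α β : Type*) [Finite α] [Finite β] (h : Nat.card α = Nat.card β) :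
    Nat.card (α ↪ β) = (Nat.card β).factorial := by
  classical
  have := Fintype.ofFinite α
  have := Fintype.ofFinite β
  rw [Nat.card_eq_fintype_card, Fintype.card_embedding_eq, ← Nat.card_eq_fintype_card,
   ← Nat.card_eq_fintype_card, h, Nat.descFactorial_self]

def Good0 (F : Type*) {W I : Type*} [Field F] [AddCommGroup W] [Module F W] (w : I → W) : Prop :=
  (∀ i, w i ≠ 0) ∧ ∀ i j, i ≠ j → ∀ b : F, w j ≠ b • w i

lemma Good0.mk_inj {w : I → W} (h : Good0 F w) :
    Function.Injective (fun i => Projectivization.mk F (w i) (h.1 i)) := by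
  intro i j hij
  by_contra hne
  obtain ⟨a, ha⟩ := (Projectivization.mk_eq_mk_iff' F _ _ (h.1 _) (h.1 _)).1 hij
  exact h.2 j i (Ne.symm hne) a ha.symm

lemma Good0.card_le {w : I → W} (h : Good0 F w) : Nat.card I ≤ Nat.card (ℙ F W) :=
  Nat.card_le_card_of_injective _ h.mk_inj

lemma card_good0 (hc : Nat.card I = Nat.card (ℙ F W)) :
    Nat.card {w : I → W // Good0 F w} =
      (Nat.card (ℙ F W)).factorial * (Nat.card F - 1) ^ Nat.card (ℙ F W) := by
  classical
  have hu : Nat.card Fˣ = Nat.card F - 1 := Nat.card_units F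
  rw [← card_emb I _ hc, ← hu]
  nth_rw 1 [← hc]
  rw [← Nat.card_fun, ← Nat.card_prod]
  symm
  have hg : ∀ x : (I ↪ ℙ F W) × (I → Fˣ), Good0 F (fun i => x.2 i • (x.1 i).rep) := by
    rintro ⟨p, u⟩
    refine ⟨fun i => ?_, fun i j hij b hb => ?_⟩
    · exact (smul_ne_zero_iff_ne (u i)).2 (Projectivization.rep_nonzero (p i))
    · apply hij
      apply p.injective
      rw [← Projectivization.mk_rep (p i), ← Projectivization.mk_rep (p j)]
      symm
      rw [Projectivization.mk_eq_mk_iff']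
      refine ⟨((u j)⁻¹ : Fˣ) * b * u i, ?_⟩
      have := congrArg (fun z => (u j)⁻¹ • z) hb
      simp only [inv_smul_smul] at this
      rw [this]
      simp [Units.smul_def, mul_smul]
  refine Nat.card_eq_of_bijective (fun x => ⟨_, hg x⟩) ⟨?_, ?_⟩
  · rintro ⟨p, u⟩ ⟨p', u'⟩ h
    have h : ∀ i, u i • (p i).rep = u' i • (p' i).rep := fun i => congrFun (congrArg Subtype.val h) i
    have hp : p = p' := by
      ext i
      rw [← Projectivization.mk_rep (p i), ← Projectivization.mk_rep (p' i)]
      rw [Projectivization.mk_eq_mk_iff]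
      refine ⟨(u i)⁻¹ * u' i, ?_⟩
      rw [mul_smul, ← h, inv_smul_smul]
    subst hp
    congr 1
    ext i
    have := h i
    simp only [Units.smul_def] at this
    exact smul_left_injective F (Projectivization.rep_nonzero (p i)) this
  · rintro ⟨w, hw⟩
    choose u hu using fun i => Projectivization.exists_smul_eq_mk_rep F (w i) (hw.1 i)
    refine ⟨(⟨_, hw.mk_inj⟩, fun i => (u i)⁻¹), ?_⟩
    apply Subtype.ext
    funext i
    simp [← hu]

def Good (F : Type*) {A W I : Type*} [Field F] [AddCommGroup W] [Module F W] [AddCommGroup A]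
    [Module F A] (φ : I → A) (w : I → W) : Prop :=
  (∀ i, φ i = 0 → w i ≠ 0) ∧ ∀ i j, i ≠ j → ∀ b : F, ¬ (φ j = b • φ i ∧ w j = b • w i)

/-- indices above a projective point -/
abbrev Fib (F : Type*) {A I : Type*} [Field F] [AddCommGroup A] [Module F A] (φ : I → A)
    (p : ℙ F A) : Type _ :=
  {i : {i : I // φ i ≠ 0} // Projectivization.mk F (φ i) i.2 = p}

noncomputable def nu (F : Type*) {A I : Type*} [Field F] [AddCommGroup A] [Module F A] (φ : I → A)
    (i : {i : I // φ i ≠ 0}) : Fˣ :=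
  (Projectivization.exists_smul_eq_mk_rep F (φ i) i.2).choose

lemma nu_spec (φ : I → A) (i : {i : I // φ i ≠ 0}) :
    nu F φ i • φ i = (Projectivization.mk F (φ i) i.2).rep :=
  (Projectivization.exists_smul_eq_mk_rep F (φ i) i.2).choose_spec

lemma Good.good0 {φ : I → A} {w : I → W} (h : Good F φ w) :
    Good0 F (fun i : {i : I // φ i = 0} => w i) := by
  refine ⟨fun i => h.1 i i.2, fun i j hij b hb => ?_⟩
  refine h.2 i j (fun h => hij (Subtype.ext h)) b ⟨?_, hb⟩
  rw [i.2, j.2, smul_zero]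

lemma Good.inj {φ : I → A} {w : I → W} (h : Good F φ w) (p : ℙ F A) :
    Function.Injective (fun i : Fib F φ p => nu F φ i.1 • w i.1) := by
  rintro ⟨i, hi⟩ ⟨j, hj⟩ hij
  by_contra hne
  have h1 := nu_spec (F := F) φ i
  rw [hi, ← hj, ← nu_spec] at h1
  dsimp only at hij
  refine h.2 i j (fun h => hne (Subtype.ext (Subtype.ext h)))
    (((nu F φ j)⁻¹ * nu F φ i : Fˣ) : F) ⟨?_, ?_⟩
  · rw [← Units.smul_def, mul_smul, h1, inv_smul_smul]
  · rw [← Units.smul_def, mul_smul, hij, inv_smul_smul]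

lemma good_of {φ : I → A} {w : I → W} (h0 : Good0 F (fun i : {i : I // φ i = 0} => w i))
    (h1 : ∀ p : ℙ F A, Function.Injective (fun i : Fib F φ p => nu F φ i.1 • w i.1)) :
    Good F φ w := by
  refine ⟨fun i hi => h0.1 ⟨i, hi⟩, ?_⟩
  rintro i j hij b ⟨hb1, hb2⟩
  by_cases hj : φ j = 0
  · by_cases hi : φ i = 0
    · exact h0.2 ⟨i, hi⟩ ⟨j, hj⟩ (fun h => hij (congrArg Subtype.val h)) b hb2
    · have : b = 0 := by
        rw [hj] at hb1
        exact (smul_eq_zero.1 hb1.symm).resolve_right hi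
      exact h0.1 ⟨j, hj⟩ (by simp [hb2, this])
  · have hi : φ i ≠ 0 := by
      intro hi
      exact hj (by rw [hb1, hi, smul_zero])
    have hp : Projectivization.mk F (φ j) hj = Projectivization.mk F (φ i) hi := by
      rw [Projectivization.mk_eq_mk_iff']
      exact ⟨b, hb1.symm⟩
    have e1 := nu_spec (F := F) φ ⟨i, hi⟩
    have e2 := nu_spec (F := F) φ ⟨j, hj⟩
    rw [← hp, ← e2] at e1
    dsimp only at e1
    rw [hb1, Units.smul_def, Units.smul_def, smul_smul] at e1
    have e3 := smul_left_injective F hi e1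
    have := @h1 _ ⟨⟨i, hi⟩, rfl⟩ ⟨⟨j, hj⟩, hp⟩ (by
      dsimp only
      rw [hb2, Units.smul_def, Units.smul_def, smul_smul, e3])
    exact hij (congrArg (fun x => x.1.1) this)

lemma card_good_prod (φ : I → A) :
    Nat.card {w : I → W // Good F φ w} =
      Nat.card ({w : {i : I // φ i = 0} → W // Good0 F w} × ((p : ℙ F A) → (Fib F φ p ↪ W))) := by
  classical
  refine Nat.card_eq_of_bijective (fun w => (⟨_, w.2.good0⟩, fun p => ⟨_, w.2.inj p⟩)) ⟨?_, ?_⟩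
  · rintro ⟨w, hw⟩ ⟨w', hw'⟩ h
    rw [Prod.mk.injEq] at h
    obtain ⟨h0, h1⟩ := h
    apply Subtype.ext
    funext i
    by_cases hi : φ i = 0
    · exact congrFun (congrArg Subtype.val h0) ⟨i, hi⟩
    · have := DFunLike.congr_fun (congrFun h1 (Projectivization.mk F (φ i) hi)) ⟨⟨i, hi⟩, rfl⟩
      simpa using this
  · rintro ⟨⟨w0, hw0⟩, g⟩
    let w : I → W := fun i => if hi : φ i = 0 then w0 ⟨i, hi⟩ else
      (nu F φ ⟨i, hi⟩)⁻¹ • g (Projectivization.mk F (φ i) hi) ⟨⟨i, hi⟩, rfl⟩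
    have e0 : (fun i : {i : I // φ i = 0} => w i) = w0 := by
      funext i
      simp [w, i.2]
    have e1 : ∀ p, (fun i : Fib F φ p => nu F φ i.1 • w i.1) = g p := by
      intro p
      funext ⟨i, hi⟩
      subst hi
      simp [w, i.2]
    have hw : Good F φ w := by
      apply good_of
      · rw [e0]; exact hw0
      · intro p
        rw [e1]
        exact (g p).injective
    refine ⟨⟨w, hw⟩, ?_⟩
    refine Prod.ext (Subtype.ext e0) ?_
    funext p
    exact DFunLike.coe_injective (e1 p)

lemma card_index (φ : I → A) :
    Nat.card I = Nat.card {i : I // φ i = 0} + Nat.card ((p : ℙ F A) × Fib F φ p) := by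
  classical
  rw [Nat.card_congr (Equiv.sigmaFiberEquiv _), ← Nat.card_sum]
  exact (Nat.card_congr (Equiv.sumCompl _)).symm

lemma card_good (φ : I → A) (hne : ∃ w : I → W, Good F φ w)
    (hI : Nat.card I = Nat.card (ℙ F W) + Nat.card (ℙ F A) * Nat.card W) :
    Nat.card {w : I → W // Good F φ w} =
      (Nat.card (ℙ F W)).factorial * (Nat.card F - 1) ^ Nat.card (ℙ F W) *
        (Nat.card W).factorial ^ Nat.card (ℙ F A) := by
  classical
  obtain ⟨w, hw⟩ := hne
  have := Fintype.ofFinite (ℙ F A)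
  have h0 := hw.good0.card_le
  have h1 : ∀ p, Nat.card (Fib F φ p) ≤ Nat.card W :=
    fun p => Nat.card_le_card_of_injective _ (hw.inj p)
  have h2 := card_index (F := F) φ
  rw [Nat.card_sigma] at h2
  have h3 : ∑ p : ℙ F A, Nat.card (Fib F φ p) ≤ ∑ p : ℙ F A, Nat.card W :=
    Finset.sum_le_sum (fun p _ => h1 p)
  have h4 : ∑ p : ℙ F A, Nat.card W = Nat.card (ℙ F A) * Nat.card W := by
    simp [Nat.card_eq_fintype_card]
  have h5 : ∑ p : ℙ F A, Nat.card (Fib F φ p) = ∑ p : ℙ F A, Nat.card W := by omega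
  have h6 := (Finset.sum_eq_sum_iff_of_le (fun p _ => h1 p)).1 h5
  rw [card_good_prod (F := F), Nat.card_prod, card_good0 (by omega), Nat.card_pi,
    Finset.prod_congr rfl (fun p hp => card_emb _ _ (h6 p hp))]
  simp

/-- tuples generating modulo a subspace -/
lemma card_gen {d m : ℕ} {V : Type*} [AddCommGroup V] [Module F V] [Finite V] (X : Submodule F V)
    (hX : finrank F X = m) (hd : finrank F V = m + d) :
    Nat.card {v : Fin d → V // X ⊔ span F (Set.range v) = ⊤} =
      (∏ i ∈ Finset.range d, (Nat.card F ^ d - Nat.card F ^ i)) * Nat.card F ^ (m * d) := by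
  classical
  have := Fintype.ofFinite F
  have hfin : Module.Finite F V := Module.Finite.of_finite
  have hq : finrank F (V ⧸ X) = d := by
    have := Submodule.finrank_quotient_add_finrank X
    omega
  have hfq : Finite (V ⧸ X) := Finite.of_surjective _ X.mkQ_surjective
  have hli := card_linearIndependent (K := F) (V := V ⧸ X) (k := d) hq.ge
  rw [hq, ← Nat.card_eq_fintype_card, ← Finset.prod_range fun i => (Nat.card F ^ d - Nat.card F ^ i)]
    at hli
  have hcX : Nat.card (Fin d → X) = Nat.card F ^ (m * d) := by
    rw [Nat.card_fun, Module.natCard_eq_pow_finrank (K := F) (V := X), hX, Nat.card_fin, pow_mul]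
  rw [← hli, ← hcX, ← Nat.card_prod]
  have key : ∀ v : Fin d → V, X ⊔ span F (Set.range v) = ⊤ ↔
      LinearIndependent F (fun i => X.mkQ (v i)) := by
    intro v
    rw [← Submodule.map_mkQ_eq_top, Submodule.map_span, ← Set.range_comp]
    constructor
    · intro h
      exact linearIndependent_of_top_le_span_of_card_eq_finrank h.ge (by simp [hq])
    · intro h
      exact h.span_eq_top_of_card_eq_finrank' (by simp [hq])
  obtain ⟨s, hs⟩ := X.mkQ_surjective.hasRightInverse
  have hsx : ∀ y (x : X), X.mkQ (s y + x) = y := by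
    intro y x
    rw [map_add, hs, X.mkQ_apply x.1, (Submodule.Quotient.mk_eq_zero X).2 x.2, add_zero]
  symm
  refine Nat.card_eq_of_bijective (fun z : {y : Fin d → V ⧸ X // LinearIndependent F y} ×
    (Fin d → X) => ⟨fun i => s (z.1.1 i) + z.2 i, (key _).2 (by simp only [hsx]; exact z.1.2)⟩) ⟨?_, ?_⟩
  · rintro ⟨⟨y, hy⟩, x⟩ ⟨⟨y', hy'⟩, x'⟩ h
    have h : ∀ i, s (y i) + x i = s (y' i) + x' i :=
      fun i => congrFun (congrArg Subtype.val h) i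
    have hy : y = y' := by
      funext i
      rw [← hsx (y i) (x i), h, hsx]
    subst hy
    congr 1
    funext i
    exact Subtype.ext (add_left_cancel (h i))
  · rintro ⟨v, hv⟩
    refine ⟨(⟨_, (key v).1 hv⟩, fun i => ⟨v i - s (X.mkQ (v i)), ?_⟩), ?_⟩
    · rw [← Submodule.Quotient.mk_eq_zero, ← X.mkQ_apply, map_sub, hs, sub_self]
    · apply Subtype.ext
      funext i
      simp

/-- version inside an ambient space -/
lemma card_gen' {d m : ℕ} {V : Type*} [AddCommGroup V] [Module F V] [Finite V]
    (X C : Submodule F V) (hXC : X ≤ C)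
    (hX : finrank F X = m) (hd : finrank F C = m + d) :
    Nat.card {v : Fin d → V // X ⊔ span F (Set.range v) = C} =
      (∏ i ∈ Finset.range d, (Nat.card F ^ d - Nat.card F ^ i)) * Nat.card F ^ (m * d) := by
  rw [← card_gen (X.submoduleOf C)
    (by rw [← hX]; exact (Submodule.submoduleOfEquivOfLe hXC).finrank_eq) hd]
  symm
  have key : ∀ v : Fin d → C, (X.submoduleOf C ⊔ span F (Set.range v) = ⊤ ↔
      X ⊔ span F (Set.range fun i => (v i : V)) = C) := by
    intro v
    rw [← (Submodule.map_injective_of_injective C.injective_subtype).eq_iff, Submodule.map_sup,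
      Submodule.map_span, ← Set.range_comp, Submodule.map_top, Submodule.range_subtype]
    rw [Submodule.submoduleOf, Submodule.map_comap_subtype, inf_eq_right.2 hXC]
    rfl
  refine Nat.card_eq_of_bijective (fun v => ⟨fun i => v.1 i, (key _).1 v.2⟩) ⟨?_, ?_⟩
  · rintro ⟨v, hv⟩ ⟨v', hv'⟩ h
    apply Subtype.ext
    funext i
    exact Subtype.ext (congrFun (congrArg Subtype.val h) i)
  · rintro ⟨v, hv⟩
    have hm : ∀ i, v i ∈ C := fun i => hv ▸ Submodule.mem_sup_right (subset_span ⟨i, rfl⟩)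
    exact ⟨⟨fun i => ⟨v i, hm i⟩, (key _).2 hv⟩, rfl⟩

/-- coordinate functionals on `X` -/
def cf {n : ℕ} (X : Submodule F (Fin n → F)) (i : Fin n) : Dual F X :=
  (LinearMap.proj i : (Fin n → F) →ₗ[F] F).comp X.subtype

lemma exists_ne_iff {d n : ℕ} (X : Submodule F (Fin n → F)) (v : Fin d → Fin n → F)
    (f : (Fin n → F) →ₗ[F] F) :
    (∃ c ∈ X ⊔ span F (Set.range v), f c ≠ 0) ↔
      ¬ (f.comp X.subtype = 0 ∧ ∀ t, f (v t) = 0) := by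
  have : (f.comp X.subtype = 0 ∧ ∀ t, f (v t) = 0) ↔
      X ⊔ span F (Set.range v) ≤ LinearMap.ker f := by
    rw [sup_le_iff, span_le, Set.range_subset_iff]
    refine and_congr ⟨fun h x hx => LinearMap.mem_ker.2 (DFunLike.congr_fun h ⟨x, hx⟩), fun h => ?_⟩ Iff.rfl
    ext x
    exact h x.2
  rw [this, SetLike.not_le_iff_exists]
  rfl

lemma card_le_of_nonprop {n : ℕ} (C : Submodule F (Fin n → F))
    (h1 : ∀ i : Fin n, ∃ c ∈ C, c i ≠ 0)
    (h2 : ∀ i j : Fin n, i ≠ j → ∀ a : F, ∃ c ∈ C, c j ≠ a * c i) :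
    n * (Nat.card F - 1) ≤ Nat.card F ^ finrank F C - 1 := by
  classical
  have : Finite (Dual F C) := Module.finite_of_finite F
  have hg : Good0 F (cf C) := by
    refine ⟨fun i hi => ?_, fun i j hij b hb => ?_⟩
    · obtain ⟨c, hc, hc'⟩ := h1 i
      exact hc' (DFunLike.congr_fun hi ⟨c, hc⟩)
    · obtain ⟨c, hc, hc'⟩ := h2 i j hij b
      exact hc' (DFunLike.congr_fun hb ⟨c, hc⟩)
  have := hg.card_le
  rw [Nat.card_fin] at this
  calc _ ≤ _ := Nat.mul_le_mul_right (Nat.card F - 1) this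
    _ = _ := by
      rw [← Projectivization.card, Module.natCard_eq_pow_finrank (K := F) (V := Dual F C),
        Subspace.dual_finrank_eq]

lemma simplex_iff_good {n m d : ℕ} (hn : n * (Nat.card F - 1) = Nat.card F ^ (m + d) - 1)
    (X : Submodule F (Fin n → F)) (hm : finrank F X = m) (v : Fin d → Fin n → F) :
    IsSimplexCode (m + d) (X ⊔ span F (Set.range v)) ↔
      Good F (cf X) (fun i t => v t i) := by
  have hA : (∀ i : Fin n, ∃ c ∈ X ⊔ span F (Set.range v), c i ≠ 0) ↔
      ∀ i, cf X i = 0 → (fun t => v t i) ≠ 0 := by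
    refine forall_congr' fun i => ?_
    have := exists_ne_iff X v (LinearMap.proj i)
    simp only [LinearMap.proj_apply] at this
    rw [this, not_and, Ne, funext_iff]
    rfl
  have hB : (∀ i j : Fin n, i ≠ j → ∀ a : F, ∃ c ∈ X ⊔ span F (Set.range v), c j ≠ a * c i) ↔
      ∀ i j, i ≠ j → ∀ b : F, ¬ (cf X j = b • cf X i ∧
        (fun t => v t j) = b • (fun t => v t i)) := by
    refine forall_congr' fun i => forall_congr' fun j => forall_congr' fun _ =>
      forall_congr' fun b => ?_
    have := exists_ne_iff X v (LinearMap.proj j - b • LinearMap.proj i)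
    simp only [LinearMap.sub_apply, LinearMap.smul_apply, LinearMap.proj_apply, sub_ne_zero,
      smul_eq_mul, LinearMap.sub_comp, LinearMap.smul_comp, sub_eq_zero] at this
    rw [this, funext_iff]
    rfl
  unfold IsSimplexCode Good
  rw [← hA, ← hB]
  refine ⟨fun h => h.2, fun h => ⟨?_, h⟩⟩
  have hle := card_le_of_nonprop _ h.1 h.2
  rw [hn] at hle
  have hF : 1 < Nat.card F := Finite.one_lt_card
  apply le_antisymm
  · refine (Submodule.finrank_add_le_finrank_add_finrank _ _).trans ?_
    rw [hm]
    gcongr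
    exact (finrank_range_le_card (R := F) v).trans (by simp)
  · have p1 : 0 < Nat.card F ^ finrank F ↥(X ⊔ span F (Set.range v)) := by positivity
    exact (Nat.pow_le_pow_iff_right hF).1 (by omega)

lemma main_aux {n m d : ℕ} (hn : n * (Nat.card F - 1) = Nat.card F ^ (m + d) - 1)
    (X : Submodule F (Fin n → F)) (hm : finrank F X = m)
    (hsub : ∃ C₀ : Submodule F (Fin n → F), IsSimplexCode (m + d) C₀ ∧ X ≤ C₀) :
    Nat.card {C : Submodule F (Fin n → F) // IsSimplexCode (m + d) C ∧ X ≤ C} *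
      ((∏ i ∈ Finset.range d, (Nat.card F ^ d - Nat.card F ^ i)) * Nat.card F ^ (m * d)) =
      Nat.factorial ((Nat.card F ^ d - 1) / (Nat.card F - 1)) *
        (Nat.card F - 1) ^ ((Nat.card F ^ d - 1) / (Nat.card F - 1)) *
        (Nat.factorial (Nat.card F ^ d)) ^ ((Nat.card F ^ m - 1) / (Nat.card F - 1)) := by
  classical
  have hF : 1 < Nat.card F := Finite.one_lt_card
  have : Finite (Dual F X) := Module.finite_of_finite F
  have hW : Nat.card (Fin d → F) = Nat.card F ^ d := by simp [Nat.card_fun]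
  have hD : Nat.card (Dual F X) = Nat.card F ^ m := by
    rw [Module.natCard_eq_pow_finrank (K := F) (V := Dual F X), Subspace.dual_finrank_eq, hm]
  have hPW := Projectivization.card' F (Fin d → F)
  have hPD := Projectivization.card' F (Dual F X)
  rw [← hW, ← hD, ← Projectivization.card'', ← Projectivization.card'']
  have hcongr : Nat.card {v : Fin d → Fin n → F //
      IsSimplexCode (m + d) (X ⊔ span F (Set.range v))} =
      Nat.card {w : Fin n → Fin d → F // Good F (cf X) w} :=
    Nat.card_congr ((Equiv.piComm _).subtypeEquiv fun v => simplex_iff_good hn X hm v)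
  have hfib : Nat.card {v : Fin d → Fin n → F //
      IsSimplexCode (m + d) (X ⊔ span F (Set.range v))} =
      Nat.card {C : Submodule F (Fin n → F) // IsSimplexCode (m + d) C ∧ X ≤ C} *
      ((∏ i ∈ Finset.range d, (Nat.card F ^ d - Nat.card F ^ i)) * Nat.card F ^ (m * d)) := by
    have hfs : Finite (Submodule F (Fin n → F)) := inferInstance
    have := Fintype.ofFinite {C : Submodule F (Fin n → F) // IsSimplexCode (m + d) C ∧ X ≤ C}
    have e : (Σ C : {C : Submodule F (Fin n → F) // IsSimplexCode (m + d) C ∧ X ≤ C},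
        {v : Fin d → Fin n → F // X ⊔ span F (Set.range v) = C.1}) ≃
        {v : Fin d → Fin n → F // IsSimplexCode (m + d) (X ⊔ span F (Set.range v))} :=
      { toFun := fun z => ⟨z.2.1, by rw [z.2.2]; exact z.1.2.1⟩
        invFun := fun v => ⟨⟨_, v.2, le_sup_left⟩, ⟨v.1, rfl⟩⟩
        left_inv := by
          rintro ⟨⟨C, hC⟩, ⟨v, hv⟩⟩
          dsimp only at hv
          subst hv
          rfl
        right_inv := fun v => rfl }
    rw [← Nat.card_congr e, Nat.card_sigma,
      Finset.sum_congr rfl fun C _ => card_gen' X C.1 C.2.2 hm C.2.1.1]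
    simp
  have hne : ∃ w : Fin n → Fin d → F, Good F (cf X) w := by
    obtain ⟨C₀, hC, hXC⟩ := hsub
    have hpos := card_gen' (d := d) X C₀ hXC hm hC.1
    have h0 : 0 < (∏ i ∈ Finset.range d, (Nat.card F ^ d - Nat.card F ^ i)) *
        Nat.card F ^ (m * d) := by
      refine Nat.mul_pos (Finset.prod_pos fun i hi => ?_) (by positivity)
      exact Nat.sub_pos_of_lt (Nat.pow_lt_pow_right hF (Finset.mem_range.1 hi))
    rw [← hpos] at h0
    obtain ⟨⟨v, hv⟩⟩ := (Nat.card_pos_iff.1 h0).1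
    exact ⟨_, (simplex_iff_good hn X hm v).1 (hv ▸ hC)⟩
  have hI : Nat.card (Fin n) = Nat.card (ℙ F (Fin d → F)) +
      Nat.card (ℙ F (Dual F X)) * Nat.card (Fin d → F) := by
    rw [Nat.card_fin]
    apply Nat.eq_of_mul_eq_mul_right (Nat.sub_pos_of_lt hF)
    rw [hn, pow_add, ← hW, ← hD, add_mul]
    have : Nat.card (Dual F X) * Nat.card (Fin d → F) =
      Nat.card (ℙ F (Dual F X)) * Nat.card (Fin d → F) * (Nat.card F - 1)
        + Nat.card (Fin d → F) := by
      nth_rw 1 [hPD]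
      ring
    rw [this]
    omega
  rw [← card_good (cf X) hne hI, ← hcongr, hfib, hW]

end Helpers

theorem card_simplex_codes_containing_subcode {F : Type*} [Field F] [Fintype F]
    {q n k m : ℕ} (hq : Fintype.card F = q) (hk : 2 ≤ k)
    (hn : n * (q - 1) = q ^ k - 1) (hmk : m ≤ k - 1)
    (X : Submodule F (Fin n → F)) (hm : Module.finrank F ↥X = m)
    (hsub : ∃ C₀ : Submodule F (Fin n → F), IsSimplexCode k C₀ ∧ X ≤ C₀) :
    Nat.card {C : Submodule F (Fin n → F) // IsSimplexCode k C ∧ X ≤ C} *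
        ((∏ i ∈ Finset.range (k - m), (q ^ (k - m) - q ^ i)) * q ^ (m * (k - m))) =
      Nat.factorial ((q ^ (k - m) - 1) / (q - 1)) *
        (q - 1) ^ ((q ^ (k - m) - 1) / (q - 1)) *
        (Nat.factorial (q ^ (k - m))) ^ ((q ^ m - 1) / (q - 1)) := by
  have hd : m + (k - m) = k := by omega
  have hc : Nat.card F = q := by rw [Nat.card_eq_fintype_card, hq]
  obtain ⟨d, rfl⟩ : ∃ d, k = m + d := ⟨k - m, hd.symm⟩
  subst hc
  rw [Nat.add_sub_cancel_left]
  exact main_aux hn X hm hsub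
end

section
/- Suppose q = 2 and k ≥ 4, or q = 3 and k ≥ 3, or q ≥ 4 (k ≥ 2). For any (k-1)-dimensional subcode X of a q-ary simplex code of dimension k, the number of simplex codes containing X equals (q!)^{[k-1]_q} / q^{k-1}, and this number is strictly greater than q + 1. -/
open Module Submodule

lemma sup_span_simplex {F : Type*} [Field F] {n k : ℕ} (hk : 1 ≤ k)
    {X C : Submodule F (Fin n → F)} (hm : Module.finrank F ↥X = k - 1)
    (hC : Module.finrank F ↥C = k) (hXC : X ≤ C) {v : Fin n → F} (hv : v ∈ C) (hvX : v ∉ X) :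
    X ⊔ span F {v} = C := by
  apply Submodule.eq_of_le_of_finrank_eq
  · exact sup_le hXC ((Submodule.span_singleton_le_iff_mem _ _).2 hv)
  · rw [Submodule.finrank_sup_span_singleton hvX]; omega

/-- Counting vectors `v` such that `X + <v>` is a simplex code, first way. -/
lemma count_A {F : Type*} [Field F] [Fintype F] {q n k : ℕ} (hq : Fintype.card F = q)
    (hk : 1 ≤ k) (X : Submodule F (Fin n → F)) (hm : Module.finrank F ↥X = k - 1) :
    Nat.card {v : Fin n → F // v ∉ X ∧ IsSimplexCode k (X ⊔ span F {v})} =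
      Nat.card {C : Submodule F (Fin n → F) // IsSimplexCode k C ∧ X ≤ C} *
        (q ^ k - q ^ (k - 1)) := by
  classical
  have e : {v : Fin n → F // v ∉ X ∧ IsSimplexCode k (X ⊔ span F {v})} ≃
      Σ C : {C : Submodule F (Fin n → F) // IsSimplexCode k C ∧ X ≤ C},
        {v : Fin n → F // v ∈ C.1 ∧ v ∉ X} :=
    { toFun := fun v => ⟨⟨X ⊔ span F {v.1}, v.2.2, le_sup_left⟩,
        ⟨v.1, (le_sup_right : span F {v.1} ≤ X ⊔ span F {v.1}) (mem_span_singleton_self _), v.2.1⟩⟩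
      invFun := fun s => ⟨s.2.1, s.2.2.2, by
        rw [sup_span_simplex hk hm s.1.2.1.1 s.1.2.2 s.2.2.1 s.2.2.2]; exact s.1.2.1⟩
      left_inv := fun v => rfl
      right_inv := by
        rintro ⟨⟨C, hC, hXC⟩, ⟨v, hv, hvX⟩⟩
        have := sup_span_simplex hk hm hC.1 hXC hv hvX
        subst this
        rfl }
  have hfin : Finite {C : Submodule F (Fin n → F) // IsSimplexCode k C ∧ X ≤ C} := inferInstance
  have := Fintype.ofFinite {C : Submodule F (Fin n → F) // IsSimplexCode k C ∧ X ≤ C}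
  rw [Nat.card_congr e, Nat.card_sigma]
  have hc : ∀ C : {C : Submodule F (Fin n → F) // IsSimplexCode k C ∧ X ≤ C},
      Nat.card {v : Fin n → F // v ∈ C.1 ∧ v ∉ X} = q ^ k - q ^ (k - 1) := by
    rintro ⟨C, hC, hXC⟩
    have h1 : Nat.card C = q ^ k := by
      rw [Module.natCard_eq_pow_finrank (K := F), hC.1, Nat.card_eq_fintype_card, hq]
    have h2 : Nat.card X = q ^ (k - 1) := by
      rw [Module.natCard_eq_pow_finrank (K := F), hm, Nat.card_eq_fintype_card, hq]
    have h3 : Nat.card ((C : Set (Fin n → F)) \ X : Set (Fin n → F)) = q ^ k - q ^ (k - 1) := by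
      rw [Nat.card_coe_set_eq, Set.ncard_sdiff (by exact_mod_cast hXC), ← Nat.card_coe_set_eq,
        ← Nat.card_coe_set_eq]
      exact congrArg₂ _ h1 h2
    exact h3
  simp only [hc, Finset.sum_const, smul_eq_mul, Finset.card_univ, Nat.card_eq_fintype_card]

lemma good_iff {F : Type*} [Field F] {n k : ℕ} (hk : 1 ≤ k)
    (X : Submodule F (Fin n → F)) (hm : Module.finrank F ↥X = k - 1)
    {P : Type*} (r : P → Dual F X) (hr0 : ∀ a, r a ≠ 0)
    (hr : ∀ a b (c : F), r a = c • r b → a = b)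
    (p : Fin n → P) (l : Fin n → F) (hp : ∀ i (x : X), x.1 i = l i * r (p i) x)
    (i₀ : Fin n) (hl : ∀ i, l i = 0 ↔ i = i₀)
    (v : Fin n → F) :
    (v ∉ X ∧ IsSimplexCode k (X ⊔ span F {v})) ↔
      (v i₀ ≠ 0 ∧ ∀ i j, i ≠ i₀ → j ≠ i₀ → p i = p j → v i / l i = v j / l j → i = j) := by
  have hl0 : l i₀ = 0 := (hl i₀).2 rfl
  have hmem : ∀ c, c ∈ X ⊔ span F {v} ↔ ∃ x : X, ∃ a : F, c = x.1 + a • v := by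
    intro c
    simp only [Submodule.mem_sup, Submodule.mem_span_singleton]
    constructor
    · rintro ⟨x, hx, _, ⟨a, rfl⟩, rfl⟩; exact ⟨⟨x, hx⟩, a, rfl⟩
    · rintro ⟨x, a, rfl⟩; exact ⟨x.1, x.2, _, ⟨a, rfl⟩, rfl⟩
  have hXm : ∀ x : X, x.1 ∈ X ⊔ span F {v} := fun x => (hmem _).2 ⟨x, 0, by simp⟩
  have hvm : v ∈ X ⊔ span F {v} := (hmem _).2 ⟨0, 1, by simp⟩
  constructor
  · rintro ⟨hvX, -, h2, h3⟩
    constructor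
    · intro h0
      obtain ⟨c, hc, hne⟩ := h2 i₀
      obtain ⟨x, a, rfl⟩ := (hmem c).1 hc
      apply hne
      simp [hp, hl0, h0]
    · intro i j hi hj hpij hv
      by_contra hij
      have hli : l i ≠ 0 := fun h => hi ((hl i).1 h)
      have hlj : l j ≠ 0 := fun h => hj ((hl j).1 h)
      obtain ⟨c, hc, hne⟩ := h3 i j hij (l j / l i)
      obtain ⟨x, a, rfl⟩ := (hmem c).1 hc
      apply hne
      simp only [Pi.add_apply, Pi.smul_apply, smul_eq_mul, hp, hpij]
      field_simp at hv ⊢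
      linear_combination (-a) * hv
  · rintro ⟨h0, hinj⟩
    have hvX : v ∉ X := by
      intro h
      have := hp i₀ ⟨v, h⟩
      simp [hl0] at this
      exact h0 this
    have hnz : ∀ i, i ≠ i₀ → ∃ x : X, x.1 i ≠ 0 := by
      intro i hi
      obtain ⟨x, hx⟩ : ∃ x, r (p i) x ≠ 0 := by
        by_contra! hcon
        exact hr0 (p i) (LinearMap.ext hcon)
      exact ⟨x, by rw [hp]; exact mul_ne_zero (fun h => hi ((hl i).1 h)) hx⟩
    refine ⟨hvX, ?_, ?_, ?_⟩
    · rw [Submodule.finrank_sup_span_singleton hvX]; omega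
    · intro i
      by_cases hi : i = i₀
      · exact ⟨v, hvm, hi ▸ h0⟩
      · obtain ⟨x, hx⟩ := hnz i hi
        exact ⟨x.1, hXm x, hx⟩
    · intro i j hij a
      by_contra! hcon
      have hva := hcon v hvm
      have hxa := fun x : X => hcon x.1 (hXm x)
      by_cases hi : i = i₀
      · obtain ⟨x, hx⟩ := hnz j (fun h => hij (hi.trans h.symm))
        apply hx
        rw [hxa, hi, hp i₀, hl0]; simp
      have hli : l i ≠ 0 := fun h => hi ((hl i).1 h)
      by_cases hj : j = i₀
      · obtain ⟨x, hx⟩ := hnz i hi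
        have h1 := hxa x
        rw [hj, hp i₀, hl0, zero_mul] at h1
        rcases mul_eq_zero.1 h1.symm with h | h
        · apply h0; rw [← hj, hva, h, zero_mul]
        · exact hx h
      have hlj : l j ≠ 0 := fun h => hj ((hl j).1 h)
      have hpp : p j = p i := by
        apply hr _ _ (a * l i / l j)
        ext x
        have := hxa x
        rw [hp, hp] at this
        simp only [LinearMap.smul_apply, smul_eq_mul]
        field_simp
        linear_combination this
      have hll : l j = a * l i := by
        obtain ⟨x, hx⟩ : ∃ x, r (p i) x ≠ 0 := by
          by_contra! hcon
          exact hr0 (p i) (LinearMap.ext hcon)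
        have := hxa x
        rw [hp, hp, hpp] at this
        apply mul_right_cancel₀ hx
        linear_combination this
      apply hij
      apply hinj i j hi hj hpp.symm
      rw [hva, hll]
      have : a ≠ 0 := by rintro rfl; apply hlj; simpa using hll
      field_simp

lemma count_good {F : Type*} [Field F] [Fintype F] {n : ℕ}
    {P : Type*} [Finite P] (p : Fin n → P) (l : Fin n → F)
    (i₀ : Fin n) (hl : ∀ i, l i = 0 ↔ i = i₀)
    (e : {i // i ≠ i₀} ≃ P × F) (he : ∀ i, (e i).1 = p i.1) :
    Nat.card {v : Fin n → F // v i₀ ≠ 0 ∧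
      ∀ i j, i ≠ i₀ → j ≠ i₀ → p i = p j → v i / l i = v j / l j → i = j} =
    (Fintype.card F - 1) * (Nat.factorial (Fintype.card F)) ^ Nat.card P := by
  classical
  have hl' : ∀ i, i ≠ i₀ → l i ≠ 0 := fun i hi h => hi ((hl i).1 h)
  have hps : ∀ a t, p (e.symm (a, t)).1 = a := fun a t => by rw [← he]; simp
  have E : {v : Fin n → F // v i₀ ≠ 0 ∧
      ∀ i j, i ≠ i₀ → j ≠ i₀ → p i = p j → v i / l i = v j / l j → i = j} ≃
      {x : F // x ≠ 0} × (P → (F ↪ F)) :=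
    { toFun := fun v => (⟨v.1 i₀, v.2.1⟩, fun a =>
        ⟨fun t => v.1 (e.symm (a, t)).1 / l (e.symm (a, t)).1, by
          intro t s hts
          have := v.2.2 _ _ (e.symm (a, t)).2 (e.symm (a, s)).2 (by rw [hps, hps]) hts
          have := e.symm.injective (Subtype.ext this)
          exact (Prod.ext_iff.1 this).2⟩)
      invFun := fun g => ⟨fun i => if h : i = i₀ then g.1.1 else
          l i * g.2 (e ⟨i, h⟩).1 (e ⟨i, h⟩).2, by
        refine ⟨by simpa using g.1.2, ?_⟩
        intro i j hi hj hpij hv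
        simp only [hi, hj, dif_neg, not_false_eq_true] at hv
        rw [mul_div_cancel_left₀ _ (hl' i hi), mul_div_cancel_left₀ _ (hl' j hj)] at hv
        have h1 : (e ⟨i, hi⟩).1 = (e ⟨j, hj⟩).1 := by rw [he, he]; exact hpij
        rw [h1] at hv
        have := e.injective (Prod.ext h1 ((g.2 _).injective hv))
        exact congrArg Subtype.val this⟩
      left_inv := by
        rintro ⟨v, hv⟩
        ext i
        by_cases h : i = i₀
        · simp [h]
        · simp only [h, dif_neg, not_false_eq_true]
          change l i * (v (e.symm (e ⟨i, h⟩)).1 / l (e.symm (e ⟨i, h⟩)).1) = v i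
          rw [Equiv.symm_apply_apply]
          exact mul_div_cancel₀ _ (hl' i h)
      right_inv := by
        rintro ⟨x, g⟩
        refine Prod.ext (by simp) ?_
        funext a
        ext t
        have hne := (e.symm (a, t)).2
        simp only [hne, dif_neg, not_false_eq_true, Function.Embedding.coeFn_mk, Subtype.coe_eta,
          Equiv.apply_symm_apply]
        exact mul_div_cancel_left₀ _ (hl' _ hne) }
  rw [Nat.card_congr E, Nat.card_prod, Nat.card_fun, Nat.card_eq_fintype_card,
    Nat.card_eq_fintype_card (α := F ↪ F), Fintype.card_embedding_eq, Nat.descFactorial_self]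
  simp

lemma count_B {F : Type*} [Field F] [Fintype F] {q n k : ℕ} (hq : Fintype.card F = q)
    (hk : 2 ≤ k) (hn : n * (q - 1) = q ^ k - 1)
    (X : Submodule F (Fin n → F)) (hm : Module.finrank F ↥X = k - 1)
    (hsub : ∃ C₀ : Submodule F (Fin n → F), IsSimplexCode k C₀ ∧ X ≤ C₀) :
    Nat.card {v : Fin n → F // v ∉ X ∧ IsSimplexCode k (X ⊔ span F {v})} =
      (q - 1) * (Nat.factorial q) ^ ((q ^ (k - 1) - 1) / (q - 1)) := by
  classical
  have hq2 : 2 ≤ q := hq ▸ Fintype.one_lt_card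
  let P := Projectivization F (Dual F X)
  have hfd : Module.finrank F (Dual F X) = k - 1 := by rw [Subspace.dual_finrank_eq, hm]
  have : Finite (Dual F X) := Module.finite_of_finite F
  have hPfin : Finite P := (Projectivization.finite_iff_of_finite F _).2 this
  have hcD : Nat.card (Dual F X) = q ^ (k - 1) := by
    rw [Module.natCard_eq_pow_finrank (K := F), hfd, Nat.card_eq_fintype_card, hq]
  have hPc : Nat.card P = (q ^ (k - 1) - 1) / (q - 1) := by
    rw [Projectivization.card'' F, hcD, Nat.card_eq_fintype_card, hq]
  have hPm : q ^ (k - 1) = Nat.card P * (q - 1) + 1 := by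
    rw [← hcD, Projectivization.card' F, Nat.card_eq_fintype_card (α := F), hq]
  have hnP : n = Nat.card P * q + 1 := by
    have h1 : q ^ k = q ^ (k - 1) * q := by rw [← pow_succ]; congr 1; omega
    rw [h1, hPm] at hn
    obtain ⟨s, rfl⟩ : ∃ s, q = s + 1 := ⟨q - 1, by omega⟩
    simp only [Nat.add_sub_cancel] at hn
    apply Nat.eq_of_mul_eq_mul_right (show 0 < s by omega)
    rw [hn]
    apply Nat.sub_eq_of_eq_add
    ring
  have hPne : Nonempty P := by
    have : Nat.card P ≠ 0 := by
      intro h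
      rw [h] at hPm
      have : 1 < q ^ (k - 1) := Nat.one_lt_pow (by omega) (by omega)
      omega
    by_contra hne
    rw [not_nonempty_iff] at hne
    exact this Nat.card_of_isEmpty
  let r : P → Dual F X := Projectivization.rep
  have hr0 : ∀ a, r a ≠ 0 := fun a => a.rep_nonzero
  have hr : ∀ a b (c : F), r a = c • r b → a = b := by
    intro a b c h
    rw [← a.mk_rep, ← b.mk_rep, Projectivization.mk_eq_mk_iff']
    exact ⟨c, h.symm⟩
  have hex : ∀ i : Fin n, ∃ (a : P) (c : F), ∀ x : X, x.1 i = c * r a x := by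
    intro i
    let f : Dual F X := (LinearMap.proj i).comp X.subtype
    have hf : ∀ x : X, f x = x.1 i := fun x => rfl
    by_cases h : f = 0
    · exact ⟨hPne.some, 0, fun x => by rw [← hf, h]; simp⟩
    · obtain ⟨c, hc⟩ := Projectivization.exists_smul_eq_mk_rep F f h
      refine ⟨Projectivization.mk F f h, (c : F)⁻¹, fun x => ?_⟩
      change _ = _ * (Projectivization.mk F f h).rep x
      rw [← hc, ← hf, LinearMap.smul_apply, Units.smul_def, smul_eq_mul, ← mul_assoc,
        inv_mul_cancel₀ c.ne_zero, one_mul]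
  choose p l hp using hex
  obtain ⟨C₀, hC₀, hXC₀⟩ := hsub
  obtain ⟨v, hv, hvX⟩ : ∃ v ∈ C₀, v ∉ X := by
    by_contra! hcon
    have : C₀ = X := le_antisymm hcon hXC₀
    have h1 := hC₀.1
    rw [this, hm] at h1
    omega
  have hCv := sup_span_simplex (by omega) hm hC₀.1 hXC₀ hv hvX
  have hmem : ∀ c ∈ C₀, ∃ x : X, ∃ a : F, c = x.1 + a • v := by
    intro c hc
    rw [← hCv] at hc
    simp only [Submodule.mem_sup, Submodule.mem_span_singleton] at hc
    obtain ⟨x, hx, _, ⟨a, rfl⟩, rfl⟩ := hc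
    exact ⟨⟨x, hx⟩, a, rfl⟩
  have hginj : Function.Injective
      (fun i : {i // l i ≠ 0} => ((p i.1, v i.1 / l i.1) : P × F)) := by
    rintro ⟨i, hi⟩ ⟨j, hj⟩ hij
    simp only [Prod.mk.injEq] at hij
    obtain ⟨h1, h2⟩ := hij
    by_contra hne
    obtain ⟨c, hc, hcn⟩ := hC₀.2.2 i j (fun h => hne (Subtype.ext h)) (l j / l i)
    obtain ⟨x, a, rfl⟩ := hmem c hc
    apply hcn
    simp only [Pi.add_apply, Pi.smul_apply, smul_eq_mul, hp, h1]
    field_simp at h2 ⊢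
    linear_combination (-a) * h2
  have hPF : Nat.card (P × F) = Nat.card P * q := by
    rw [Nat.card_prod, Nat.card_eq_fintype_card (α := F), hq]
  obtain ⟨i₀, hi₀⟩ : ∃ i₀, l i₀ = 0 := by
    by_contra! hcon
    have h1 := Nat.card_le_card_of_injective _ hginj
    rw [Nat.card_congr (Equiv.subtypeUnivEquiv hcon), hPF, Nat.card_eq_fintype_card,
      Fintype.card_fin] at h1
    omega
  have hl : ∀ i, l i = 0 ↔ i = i₀ := by
    intro i
    refine ⟨fun hi => ?_, fun h => h ▸ hi₀⟩
    by_contra hne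
    have hv0 : v i₀ ≠ 0 := by
      intro h0
      obtain ⟨c, hc, hcn⟩ := hC₀.2.1 i₀
      obtain ⟨x, a, rfl⟩ := hmem c hc
      apply hcn
      simp [hp, hi₀, h0]
    obtain ⟨c, hc, hcn⟩ := hC₀.2.2 i₀ i (fun h => hne h.symm) (v i / v i₀)
    obtain ⟨x, a, rfl⟩ := hmem c hc
    apply hcn
    simp only [Pi.add_apply, Pi.smul_apply, smul_eq_mul, hp, hi, hi₀]
    field_simp
    ring
  have hbij : Function.Bijective
      (fun i : {i // i ≠ i₀} => ((p i.1, v i.1 / l i.1) : P × F)) := by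
    rw [Nat.bijective_iff_injective_and_card]
    constructor
    · intro i j hij
      have := @hginj ⟨i.1, fun h => i.2 ((hl _).1 h)⟩ ⟨j.1, fun h => j.2 ((hl _).1 h)⟩ hij
      exact Subtype.ext (Subtype.mk.inj this)
    · rw [hPF, Nat.card_eq_fintype_card]
      simp [Fintype.card_subtype_compl]
      omega
  rw [Nat.card_congr (Equiv.subtypeEquivRight
    (good_iff (by omega : 1 ≤ k) X hm r hr0 hr p l hp i₀ hl)),
    count_good p l i₀ hl (Equiv.ofBijective _ hbij) (fun i => rfl), hq, hPc]

lemma bound_aux {q : ℕ} (hq : 2 ≤ q) (a b : ℕ) (hab : a ≤ b)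
    (h : (q + 1) * q ^ a < (Nat.factorial q) ^ (∑ i ∈ Finset.range a, q ^ i)) :
    (q + 1) * q ^ b < (Nat.factorial q) ^ (∑ i ∈ Finset.range b, q ^ i) := by
  induction b, hab using Nat.le_induction with
  | base => exact h
  | succ b hb ih =>
    rw [Finset.sum_range_succ, pow_add _ _ (q ^ b), pow_succ q b, ← mul_assoc]
    have h1 : q ≤ Nat.factorial q ^ (q ^ b) :=
      (Nat.self_le_factorial q).trans (Nat.le_self_pow (by positivity) _)
    calc (q + 1) * q ^ b * q < Nat.factorial q ^ (∑ i ∈ Finset.range b, q ^ i) * q :=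
          Nat.mul_lt_mul_of_pos_right ih (by omega)
      _ ≤ _ := Nat.mul_le_mul_left _ h1

lemma fact_aux {q : ℕ} (hq : 4 ≤ q) : (q + 1) * q < Nat.factorial q := by
  induction q, hq using Nat.le_induction with
  | base => decide
  | succ q hq ih => rw [Nat.factorial_succ]; nlinarith

theorem card_simplex_codes_containing_hyperplane {F : Type*} [Field F] [Fintype F]
    {q n k : ℕ} (hq : Fintype.card F = q)
    (hcase : (q = 2 ∧ 4 ≤ k) ∨ (q = 3 ∧ 3 ≤ k) ∨ (4 ≤ q ∧ 2 ≤ k))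
    (hn : n * (q - 1) = q ^ k - 1)
    (X : Submodule F (Fin n → F)) (hm : Module.finrank F ↥X = k - 1)
    (hsub : ∃ C₀ : Submodule F (Fin n → F), IsSimplexCode k C₀ ∧ X ≤ C₀) :
    Nat.card {C : Submodule F (Fin n → F) // IsSimplexCode k C ∧ X ≤ C} * q ^ (k - 1) =
        (Nat.factorial q) ^ ((q ^ (k - 1) - 1) / (q - 1)) ∧
    q + 1 < Nat.card {C : Submodule F (Fin n → F) // IsSimplexCode k C ∧ X ≤ C} := by
  have hk : 2 ≤ k := by omega
  have hq2 : 2 ≤ q := by omega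
  have hA := count_A hq (by omega) X hm
  rw [count_B hq hk hn X hm hsub] at hA
  set N := Nat.card {C : Submodule F (Fin n → F) // IsSimplexCode k C ∧ X ≤ C}
  have hkk : q ^ k = q ^ (k - 1) * q := by rw [← pow_succ]; congr 1; omega
  have hd : q ^ k - q ^ (k - 1) = q ^ (k - 1) * (q - 1) := by
    rw [hkk, Nat.mul_sub, mul_one]
  rw [hd] at hA
  have hmain : N * q ^ (k - 1) = (Nat.factorial q) ^ ((q ^ (k - 1) - 1) / (q - 1)) := by
    apply Nat.eq_of_mul_eq_mul_left (show 0 < q - 1 by omega)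
    rw [hA]; ring
  refine ⟨hmain, ?_⟩
  have hb : (q + 1) * q ^ (k - 1) <
      (Nat.factorial q) ^ (∑ i ∈ Finset.range (k - 1), q ^ i) := by
    rcases hcase with ⟨rfl, h⟩ | ⟨rfl, h⟩ | ⟨h, -⟩
    · exact bound_aux hq2 3 _ (by omega) (by decide)
    · exact bound_aux hq2 2 _ (by omega) (by decide)
    · exact bound_aux hq2 1 _ (by omega) (by simpa using fact_aux h)
  rw [Nat.geomSum_eq hq2, ← hmain] at hb
  exact Nat.lt_of_mul_lt_mul_right hb
end
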